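/- Let L be a mixed 1-stack 1-queue layout of G(k,ℓ) with k > 1 and ℓ > 4. Then the vertices and edges of the subgraph G(k-1,ℓ) do not form Pattern P.1 in L: there are no seven vertices p1,…,p7 of G(k-1,ℓ), ordered p1 ≺ p2 ≺ … ≺ p7 or p7 ≺ p6 ≺ … ≺ p1, such that {p1,p3}, {p1,p6}, {p4,p5} are stack-edges of G(k-1,ℓ) and {p2,p7} is a queue-edge of G(k-1,ℓ). -/

import Mathlib

/-- Vertices for the graphs `G(k,ℓ)`: two base vertices and, for each step `k`,
each oriented edge `(u,v)` and each index `i : Fin ℓ`, a potential attached vertex. -/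
inductive PV (ℓ : ℕ) : Type where
  | A : PV ℓ
  | B : PV ℓ
  | att : ℕ → PV ℓ → PV ℓ → Fin ℓ → PV ℓ

/-- The (canonically oriented) edges of `G(k,ℓ)`: `G(1,ℓ)` is the single edge `(A,B)`,
and for `k > 1`, `G(k,ℓ)` is obtained from `G(k-1,ℓ)` by attaching `ℓ` new vertices
to each of its edges. -/
def Gedges (ℓ : ℕ) : ℕ → Set (PV ℓ × PV ℓ)
  | 0 => ∅
  | 1 => {p | p = (PV.A, PV.B)}
  | (k + 2) => Gedges ℓ (k + 1) ∪
      {p | ∃ u v, ∃ i : Fin ℓ, (u, v) ∈ Gedges ℓ (k + 1) ∧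
        (p = (PV.att (k + 2) u v i, u) ∨ p = (PV.att (k + 2) u v i, v))}

/-- The graph `G(k,ℓ)`. -/
def Gkl (k ℓ : ℕ) : SimpleGraph (PV ℓ) :=
  SimpleGraph.fromEdgeSet ((fun p => s(p.1, p.2)) '' Gedges ℓ k)

/-- The graph `Ḡ(k,ℓ)` induced by the edges of `G(k,ℓ)` that are not in `G(k-1,ℓ)`. -/
def Gbar (k ℓ : ℕ) : SimpleGraph (PV ℓ) :=
  SimpleGraph.fromEdgeSet ((fun p => s(p.1, p.2)) '' (Gedges ℓ k \ Gedges ℓ (k - 1)))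

/-- A mixed 1-stack 1-queue layout of a graph `G`: a strict total (linear) order `lt`
on the vertices together with an assignment of each edge to the stack (`isStack e`)
or to the queue (`¬ isStack e`), such that no two stack-edges cross and no two
queue-edges nest. -/
structure MixedLayout {V : Type} (G : SimpleGraph V) where
  lt : V → V → Prop
  isSTO : IsStrictTotalOrder V lt
  isStack : Sym2 V → Prop
  noCross : ∀ a b c d : V, G.Adj a b → G.Adj c d →
    isStack s(a, b) → isStack s(c, d) → ¬(lt a c ∧ lt c b ∧ lt b d)
  noNest : ∀ a b c d : V, G.Adj a b → G.Adj c d →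
    ¬isStack s(a, b) → ¬isStack s(c, d) → ¬(lt a c ∧ lt c d ∧ lt d b)

/-- `{a,b}` is an edge of the subgraph `H` that is a stack-edge in the layout `L`. -/
def SEdgeIn {V : Type} {G : SimpleGraph V} (L : MixedLayout G) (H : SimpleGraph V)
    (a b : V) : Prop :=
  H.Adj a b ∧ L.isStack s(a, b)

/-- `{a,b}` is an edge of the subgraph `H` that is a queue-edge in the layout `L`. -/
def QEdgeIn {V : Type} {G : SimpleGraph V} (L : MixedLayout G) (H : SimpleGraph V)
    (a b : V) : Prop :=
  H.Adj a b ∧ ¬L.isStack s(a, b)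

/-- `x` is a stack-attachment of the edge `{u,v}`: both `{x,u}` and `{x,v}` are
stack-edges. -/
def StackAtt {V : Type} {G : SimpleGraph V} (L : MixedLayout G) (x u v : V) : Prop :=
  SEdgeIn L G x u ∧ SEdgeIn L G x v

/-- `x` is a queue-attachment of the edge `{u,v}`: both `{x,u}` and `{x,v}` are
queue-edges. -/
def QueueAtt {V : Type} {G : SimpleGraph V} (L : MixedLayout G) (x u v : V) : Prop :=
  QEdgeIn L G x u ∧ QEdgeIn L G x v

/-- `x` is a mixed-attachment of the edge `{u,v}`: one of `{x,u}`, `{x,v}` is a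
stack-edge and the other is a queue-edge. -/
def MixedAtt {V : Type} {G : SimpleGraph V} (L : MixedLayout G) (x u v : V) : Prop :=
  (SEdgeIn L G x u ∧ QEdgeIn L G x v) ∨ (QEdgeIn L G x u ∧ SEdgeIn L G x v)

/-- `x` is one of the vertices of `Ḡ(k,ℓ)` attached to the edge `{u,v}`, i.e. both
`{x,u}` and `{x,v}` are edges of `Ḡ(k,ℓ)`. -/
def AttachedAt (ℓ k : ℕ) (x u v : PV ℓ) : Prop :=
  (Gbar k ℓ).Adj x u ∧ (Gbar k ℓ).Adj x v

/-- A smiley face `⟨a,b,u,v,c,d⟩` formed by vertices and edges of the subgraph `H`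
in the layout `L`: `a ≺ b ≺ u ≺ v ≺ c ≺ d`, the edges `{a,b}`, `{c,d}`, `{a,d}` of `H`
are queue-edges and the edge `{u,v}` of `H` is a stack-edge. -/
def Smiley {V : Type} {G : SimpleGraph V} (L : MixedLayout G) (H : SimpleGraph V)
    (a b u v c d : V) : Prop :=
  L.lt a b ∧ L.lt b u ∧ L.lt u v ∧ L.lt v c ∧ L.lt c d ∧
  QEdgeIn L H a b ∧ QEdgeIn L H c d ∧ QEdgeIn L H a d ∧ SEdgeIn L H u v

/-- Reversing the vertex order of a mixed layout gives a mixed layout. -/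
def MixedLayout.reverse {V : Type} {G : SimpleGraph V} (L : MixedLayout G) :
    MixedLayout G where
  lt a b := L.lt b a
  isSTO := haveI := L.isSTO; inferInstanceAs (IsStrictTotalOrder V (Function.swap L.lt))
  isStack := L.isStack
  noCross a b c d hab hcd sab scd h :=
    L.noCross d c b a hcd.symm hab.symm (Sym2.eq_swap ▸ scd) (Sym2.eq_swap ▸ sab)
      ⟨h.2.2, h.2.1, h.1⟩
  noNest a b c d hab hcd sab scd h :=
    L.noNest b a d c hab.symm hcd.symm (Sym2.eq_swap ▸ sab) (Sym2.eq_swap ▸ scd)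
      ⟨h.2.2, h.2.1, h.1⟩

/-- In a layout containing Pattern P.1, the edge `{p4,p5}` has at most four common
neighbours of its endpoints other than `p1`. -/
theorem MixedLayout.card_commonNeighbors_le_of_pattern {V : Type} {G : SimpleGraph V}
    (L : MixedLayout G) {p1 p2 p3 p4 p5 p6 p7 : V}
    (h12 : L.lt p1 p2) (h23 : L.lt p2 p3) (h34 : L.lt p3 p4) (h45 : L.lt p4 p5)
    (h56 : L.lt p5 p6) (h67 : L.lt p6 p7)
    (s13 : SEdgeIn L G p1 p3) (s16 : SEdgeIn L G p1 p6) (q27 : QEdgeIn L G p2 p7)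
    {ℓ : ℕ} (x : Fin ℓ → V) (hx : Function.Injective x)
    (hx4 : ∀ i, G.Adj (x i) p4) (hx5 : ∀ i, G.Adj (x i) p5) (hx1 : ∀ i, x i ≠ p1) :
    ℓ ≤ 4 := by
  classical
  have := L.isSTO
  let _ : LinearOrder V := linearOrderOfSTO L.lt
  have stack_pos : ∀ y v, p4 ≤ v → v ≤ p5 → y ≠ p1 → G.Adj y v → L.isStack s(y, v) →
      p3 ≤ y ∧ y ≤ p6 := by
    intro y v h4 h5 h1 hadj hs
    have hs' : L.isStack s(v, y) := Sym2.eq_swap ▸ hs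
    have c1 : ¬(y < p1 ∧ p1 < v ∧ v < p6) := L.noCross y v p1 p6 hadj s16.1 hs s16.2
    have c2 : ¬(p1 < y ∧ y < p3 ∧ p3 < v) := L.noCross p1 p3 y v s13.1 hadj s13.2 hs
    have c3 : ¬(p1 < v ∧ v < p6 ∧ p6 < y) :=
      L.noCross p1 p6 v y s16.1 hadj.symm s16.2 hs'
    change p1 < p2 at h12; change p2 < p3 at h23; change p3 < p4 at h34
    change p4 < p5 at h45; change p5 < p6 at h56; change p6 < p7 at h67
    grind
  have queue_pos : ∀ y v, p4 ≤ v → v ≤ p5 → y ≠ v → G.Adj y v → ¬L.isStack s(y, v) →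
      y ≤ p2 ∨ p7 ≤ y := by
    intro y v h4 h5 hne hadj hs
    have hs' : ¬L.isStack s(v, y) := Sym2.eq_swap ▸ hs
    have c1 : ¬(p2 < y ∧ y < v ∧ v < p7) := L.noNest p2 p7 y v q27.1 hadj q27.2 hs
    have c2 : ¬(p2 < v ∧ v < y ∧ y < p7) := L.noNest p2 p7 v y q27.1 hadj.symm q27.2 hs'
    change p1 < p2 at h12; change p2 < p3 at h23; change p3 < p4 at h34
    change p4 < p5 at h45; change p5 < p6 at h56; change p6 < p7 at h67
    grind
  change p1 < p2 at h12; change p2 < p3 at h23; change p3 < p4 at h34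
  change p4 < p5 at h45; change p5 < p6 at h56; change p6 < p7 at h67
  have position : ∀ i, ((¬L.isStack s(x i, p4) ∧ ¬L.isStack s(x i, p5)) ∧
        (x i ≤ p2 ∨ p7 ≤ x i)) ∨
      ((L.isStack s(x i, p4) ∧ L.isStack s(x i, p5)) ∧ p3 ≤ x i ∧ x i ≤ p6) := by
    intro i
    have s4 := stack_pos (x i) p4 le_rfl h45.le (hx1 i) (hx4 i)
    have s5 := stack_pos (x i) p5 h45.le le_rfl (hx1 i) (hx5 i)
    have q4 := queue_pos (x i) p4 le_rfl h45.le (hx4 i).ne (hx4 i)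
    have q5 := queue_pos (x i) p5 h45.le le_rfl (hx5 i).ne (hx5 i)
    grind
  let region : Fin ℓ → Fin 4 := fun i =>
    if x i ≤ p2 then 0 else if p7 ≤ x i then 1 else if p4 < x i ∧ x i < p5 then 2 else 3
  have separated : ∀ i j, x i < x j → region i ≠ region j := by
    intro i j hij heq
    have a4 := hx4 i
    have a5 := hx5 i
    have b4 := hx4 j
    have b5 := hx5 j
    have ne := a4.ne
    have ne' := a5.ne
    have me := b4.ne
    have me' := b5.ne
    have n1 : _ → _ → ¬(x i < x j ∧ x j < p4 ∧ p4 < p5) :=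
      L.noNest (x i) p5 (x j) p4 a5 b4
    have n2 : _ → _ → ¬(p4 < p5 ∧ p5 < x i ∧ x i < x j) :=
      L.noNest p4 (x j) p5 (x i) b4.symm a5.symm
    have c1 : _ → _ → ¬(x i < x j ∧ x j < p4 ∧ p4 < p5) :=
      L.noCross (x i) p4 (x j) p5 a4 b5
    have c2 : _ → _ → ¬(p4 < x i ∧ x i < x j ∧ x j < p5) :=
      L.noCross p4 (x j) (x i) p5 b4.symm a5
    have c3 : _ → _ → ¬(p4 < p5 ∧ p5 < x i ∧ x i < x j) :=
      L.noCross p4 (x i) p5 (x j) a4.symm b5.symm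
    have c4 : _ → _ → ¬(x i < p4 ∧ p4 < p5 ∧ p5 < x j) :=
      L.noCross (x i) p5 p4 (x j) a5 b4.symm
    rw [Sym2.eq_swap (a := p4), Sym2.eq_swap (a := p5)] at n2 c3
    rw [Sym2.eq_swap (a := p4)] at c2 c4
    have hi := position i
    have hj := position j
    simp only [region] at heq
    clear position hx4 hx5 hx1 stack_pos queue_pos a4 a5 b4 b5 region
    generalize L.isStack s(x i, p4) = si4 at *
    generalize L.isStack s(x i, p5) = si5 at *
    generalize L.isStack s(x j, p4) = sj4 at *
    generalize L.isStack s(x j, p5) = sj5 at *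
    rcases hi with ⟨⟨hi4, hi5⟩, hi⟩ | ⟨⟨hi4, hi5⟩, hi⟩ <;>
      rcases hj with ⟨⟨hj4, hj5⟩, hj⟩ | ⟨⟨hj4, hj5⟩, hj⟩ <;>
      simp only [hi4, hi5, hj4, hj5, not_true, not_false_iff, true_implies, false_implies]
        at n1 n2 c1 c2 c3 c4 <;>
      split_ifs at heq <;> grind
  by_contra! hl
  obtain ⟨i, j, hne, heq⟩ := Fintype.exists_ne_map_eq_of_card_lt region (by simpa using hl)
  rcases lt_or_gt_of_ne (hx.ne hne) with h | h
  · exact separated i j h heq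
  · exact separated j i h heq.symm

/-- The step at which a vertex is attached (`0` for the base vertices). -/
def PV.level {ℓ : ℕ} : PV ℓ → ℕ
  | .A => 0
  | .B => 0
  | .att n _ _ _ => n

theorem level_le_of_mem_Gedges {ℓ : ℕ} : ∀ {n : ℕ} {u v : PV ℓ},
    (u, v) ∈ Gedges ℓ n → u.level ≤ n ∧ v.level ≤ n
  | 0, _, _, h => h.elim
  | 1, _, _, h => by
    obtain ⟨rfl, rfl⟩ := Prod.mk.inj h
    simp [PV.level]
  | n + 2, u, v, h => by
    rcases h with h | ⟨a, b, i, hab, h | h⟩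
    · have := level_le_of_mem_Gedges h
      omega
    all_goals
      have := level_le_of_mem_Gedges hab
      obtain ⟨rfl, rfl⟩ := Prod.mk.inj h
      exact ⟨le_rfl, by omega⟩

theorem Gkl_adj_iff {k ℓ : ℕ} {u v : PV ℓ} :
    (Gkl k ℓ).Adj u v ↔ ((u, v) ∈ Gedges ℓ k ∨ (v, u) ∈ Gedges ℓ k) ∧ u ≠ v := by
  simp only [Gkl, SimpleGraph.fromEdgeSet_adj, Set.mem_image, Prod.exists, Sym2.eq_iff]
  grind

theorem Gkl_level_le {k ℓ : ℕ} {u v : PV ℓ} (h : (Gkl k ℓ).Adj u v) :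
    u.level ≤ k ∧ v.level ≤ k := by
  rcases (Gkl_adj_iff.1 h).1 with h | h
  · exact level_le_of_mem_Gedges h
  · exact (level_le_of_mem_Gedges h).symm

theorem Gkl_adj_succ {n ℓ : ℕ} {u v : PV ℓ} (h : (Gkl (n + 1) ℓ).Adj u v) :
    (Gkl (n + 2) ℓ).Adj u v :=
  Gkl_adj_iff.2 ⟨(Gkl_adj_iff.1 h).1.imp Or.inl Or.inl, h.ne⟩

/-- Every edge of `G(n+1,ℓ)` has `ℓ` common neighbours in `G(n+2,ℓ)` that are not vertices
of `G(n+1,ℓ)`. -/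
theorem Gkl_exists_attachments {n ℓ : ℕ} {u v : PV ℓ} (h : (Gkl (n + 1) ℓ).Adj u v) :
    ∃ x : Fin ℓ → PV ℓ, Function.Injective x ∧ (∀ i, (Gkl (n + 2) ℓ).Adj (x i) u) ∧
      (∀ i, (Gkl (n + 2) ℓ).Adj (x i) v) ∧ ∀ i, (x i).level = n + 2 := by
  have attach : ∀ a b, (a, b) ∈ Gedges ℓ (n + 1) → ∃ x : Fin ℓ → PV ℓ,
      Function.Injective x ∧ (∀ i, (Gkl (n + 2) ℓ).Adj (x i) a) ∧
      (∀ i, (Gkl (n + 2) ℓ).Adj (x i) b) ∧ ∀ i, (x i).level = n + 2 := by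
    intro a b hab
    obtain ⟨ha, hb⟩ := level_le_of_mem_Gedges hab
    refine ⟨fun i => .att (n + 2) a b i, fun i j hij => (PV.att.inj hij).2.2.2,
      fun i => Gkl_adj_iff.2 ⟨Or.inl (Or.inr ⟨a, b, i, hab, Or.inl rfl⟩), fun he => ?_⟩,
      fun i => Gkl_adj_iff.2 ⟨Or.inl (Or.inr ⟨a, b, i, hab, Or.inr rfl⟩), fun he => ?_⟩,
      fun _ => rfl⟩
    · rw [← he, PV.level] at ha
      omega
    · rw [← he, PV.level] at hb
      omega
  rcases (Gkl_adj_iff.1 h).1 with h | h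
  · exact attach u v h
  · obtain ⟨x, hx, hv, hu, hlevel⟩ := attach v u h
    exact ⟨x, hx, hu, hv, hlevel⟩

/-- Pattern P.1 is forbidden: no seven vertices `p1 ≺ … ≺ p7` (or `p7 ≺ … ≺ p1`)
of `G(k-1,ℓ)` with stack-edges `{p1,p3}`, `{p1,p6}`, `{p4,p5}` and queue-edge
`{p2,p7}` of `G(k-1,ℓ)`. -/
theorem no_pattern_P1 (k ℓ : ℕ) (hk : 1 < k) (hl : 4 < ℓ)
    (L : MixedLayout (Gkl k ℓ)) :
    ¬∃ p1 p2 p3 p4 p5 p6 p7 : PV ℓ,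
      ((L.lt p1 p2 ∧ L.lt p2 p3 ∧ L.lt p3 p4 ∧ L.lt p4 p5 ∧ L.lt p5 p6 ∧ L.lt p6 p7) ∨
        (L.lt p7 p6 ∧ L.lt p6 p5 ∧ L.lt p5 p4 ∧ L.lt p4 p3 ∧ L.lt p3 p2 ∧ L.lt p2 p1)) ∧
      SEdgeIn L (Gkl (k - 1) ℓ) p1 p3 ∧ SEdgeIn L (Gkl (k - 1) ℓ) p1 p6 ∧
      SEdgeIn L (Gkl (k - 1) ℓ) p4 p5 ∧ QEdgeIn L (Gkl (k - 1) ℓ) p2 p7 := by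
  rintro ⟨p1, p2, p3, p4, p5, p6, p7, hord, s13, s16, s45, q27⟩
  obtain ⟨n, rfl⟩ : ∃ n, k = n + 2 := ⟨k - 2, by omega⟩
  obtain ⟨x, hx, hx4, hx5, hlevel⟩ := Gkl_exists_attachments s45.1
  have hx1 : ∀ i, x i ≠ p1 := by
    rintro i rfl
    have h := (Gkl_level_le s13.1).1
    rw [hlevel i] at h
    omega
  have t13 := Gkl_adj_succ s13.1
  have t16 := Gkl_adj_succ s16.1
  have t27 := Gkl_adj_succ q27.1
  refine hl.not_ge ?_
  rcases hord with ⟨h12, h23, h34, h45, h56, h67⟩ | ⟨h76, h65, h54, h43, h32, h21⟩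
  · exact L.card_commonNeighbors_le_of_pattern h12 h23 h34 h45 h56 h67
      ⟨t13, s13.2⟩ ⟨t16, s16.2⟩ ⟨t27, q27.2⟩ x hx hx4 hx5 hx1
  · exact L.reverse.card_commonNeighbors_le_of_pattern h21 h32 h43 h54 h65 h76
      ⟨t13, s13.2⟩ ⟨t16, s16.2⟩ ⟨t27, q27.2⟩ x hx hx4 hx5 hx1
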